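/- Let U be a domain in ℝⁿ and F : U → ℝ² a harmonic map whose total derivative has rank at most one at every point of U. Then the image F(U) is contained in an affine line of ℝ² (or is a single point). -/

import Mathlib

open Filter Topology Metric

noncomputable section

/-- `ℝ^m` with the Euclidean structure. -/
abbrev E (m : ℕ) := EuclideanSpace ℝ (Fin m)

/-- The Laplacian of `f` at `x`. -/
noncomputable def lap {m : ℕ} (f : E m → ℝ) (x : E m) : ℝ :=
  ∑ i, fderiv ℝ (fun y => fderiv ℝ f y (EuclideanSpace.single i 1)) x (EuclideanSpace.single i 1)

/-- `f` is harmonic on `U`: real-valued, `C²` with vanishing Laplacian. -/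
def HarmOn {m : ℕ} (U : Set (E m)) (f : E m → ℝ) : Prop :=
  ContDiffOn ℝ 2 f U ∧ ∀ x ∈ U, lap f x = 0

/-- `f̃ x = |∇f(x)| / cosh (f x)`. -/
noncomputable def tilde {m : ℕ} (f : E m → ℝ) (x : E m) : ℝ :=
  ‖gradient f x‖ / Real.cosh (f x)

/-- `S(x) = arctan (sinh x)`, extended to `[-∞,+∞]` by `S(±∞) = ±π/2`.  The distance on
`[-∞,+∞]` is `d(x,y) = |S x - S y|`. -/
noncomputable def SF : EReal → ℝ := fun x =>
  if x = ⊤ then Real.pi / 2 else if x = ⊥ then -(Real.pi / 2)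
  else Real.arctan (Real.sinh x.toReal)

/-- Uniform convergence on every compact subset of `U`, with respect to the distance
`d(x,y) = |S x - S y|` on `[-∞,+∞]`. -/
def TendstoCptsE {m : ℕ} (U : Set (E m)) (g : ℕ → E m → EReal) (G : E m → EReal) : Prop :=
  ∀ K ⊆ U, IsCompact K → ∀ ε > 0, ∃ N : ℕ, ∀ n ≥ N, ∀ x ∈ K, |SF (g n x) - SF (G x)| < ε

/-- A family `Fam` of harmonic functions on `U` is normal if every sequence in `Fam` has a
subsequence converging uniformly on compact subsets of `U` either to a harmonic function on
`U`, or to the constant `+∞`, or to the constant `-∞`. -/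
def NormalFam {m : ℕ} (U : Set (E m)) (Fam : Set (E m → ℝ)) : Prop :=
  ∀ f : ℕ → E m → ℝ, (∀ n, f n ∈ Fam) →
    ∃ φ : ℕ → ℕ, StrictMono φ ∧
      ((∃ g : E m → ℝ, HarmOn U g ∧
          TendstoCptsE U (fun k x => ((f (φ k) x : ℝ) : EReal)) (fun x => ((g x : ℝ) : EReal)))
       ∨ TendstoCptsE U (fun k x => ((f (φ k) x : ℝ) : EReal)) (fun _ => (⊤ : EReal))
       ∨ TendstoCptsE U (fun k x => ((f (φ k) x : ℝ) : EReal)) (fun _ => (⊥ : EReal)))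


/-- The radial weight `(1 - |y|²)₊`. -/
def eta {n : ℕ} (y : E n) : ℝ := max (1 - ‖y‖ ^ 2) 0

/-- A radial primitive: `∇ psi = eta • y`. -/
def psi {n : ℕ} (y : E n) : ℝ := -(1 / 4) * (eta y) ^ 2

/-- The mass of the weight. -/
def cmass (n : ℕ) : ℝ := ∫ y : E n, eta y

lemma eta_cont {n : ℕ} : Continuous (eta : E n → ℝ) := by
  unfold eta; fun_prop

lemma psi_cont {n : ℕ} : Continuous (psi : E n → ℝ) := by
  unfold psi; have := eta_cont (n := n); fun_prop

lemma eta_nonneg {n : ℕ} (y : E n) : 0 ≤ eta y := le_max_right _ _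

lemma eta_zero_of {n : ℕ} {y : E n} (h : 1 ≤ ‖y‖) : eta y = 0 := by
  unfold eta; apply max_eq_right; nlinarith

lemma eta_supp {n : ℕ} : HasCompactSupport (eta : E n → ℝ) := by
  apply HasCompactSupport.intro (isCompact_closedBall (0 : E n) 1)
  intro x hx
  apply eta_zero_of
  simp at hx; exact hx.le

lemma psi_supp {n : ℕ} : HasCompactSupport (psi : E n → ℝ) := by
  apply HasCompactSupport.intro (isCompact_closedBall (0 : E n) 1)
  intro x hx
  have : eta x = 0 := by
    apply eta_zero_of
    simp at hx; exact hx.le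
  simp [psi, this]

lemma cmass_pos (n : ℕ) : 0 < cmass n := by
  apply Continuous.integral_pos_of_hasCompactSupport_nonneg_nonzero eta_cont eta_supp
    (fun y => eta_nonneg y) (x := 0)
  simp [eta]

lemma hasDerivAt_posSq (t : ℝ) : HasDerivAt (fun s : ℝ => (max s 0) ^ 2) (2 * max t 0) t := by
  rcases lt_trichotomy t 0 with h | h | h
  · rw [max_eq_right h.le]
    have : (fun s : ℝ => (max s 0) ^ 2) =ᶠ[𝓝 t] fun _ => 0 := by
      filter_upwards [Iio_mem_nhds h] with s hs
      simp [max_eq_right (le_of_lt (Set.mem_Iio.1 hs))]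
    simpa using (hasDerivAt_const t (0 : ℝ)).congr_of_eventuallyEq this
  · subst h
    simp only [max_self, mul_zero]
    rw [hasDerivAt_iff_isLittleO]
    simp only [sub_zero, max_self, smul_zero]
    have h1 : (fun s : ℝ => (max s 0) ^ 2 - 0 ^ 2) =O[𝓝 0] fun s => s ^ 2 := by
      apply Asymptotics.IsBigO.of_bound 1
      filter_upwards with s
      simp only [Real.norm_eq_abs, one_mul]
      rcases le_total s 0 with h | h
      · simp [h]; positivity
      · simp [h]
    refine h1.trans_isLittleO ?_
    have := Asymptotics.isLittleO_pow_id (𝕜 := ℝ) (n := 2) (by norm_num)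
    simpa using this
  · rw [max_eq_left h.le]
    have : (fun s : ℝ => (max s 0) ^ 2) =ᶠ[𝓝 t] fun s => s ^ 2 := by
      filter_upwards [Ioi_mem_nhds h] with s hs
      simp [max_eq_left (le_of_lt (Set.mem_Ioi.1 hs))]
    simpa using (hasDerivAt_pow 2 t).congr_of_eventuallyEq this

lemma psi_fderiv {n : ℕ} (y : E n) : HasFDerivAt (psi : E n → ℝ) (eta y • innerSL ℝ y) y := by
  have h1 : HasFDerivAt (fun y : E n => 1 - ‖y‖ ^ 2) (-(2 • innerSL ℝ y)) y := by
    have := (hasStrictFDerivAt_norm_sq y).hasFDerivAt.const_sub (1 : ℝ)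
    simpa using this
  have h2 := ((hasDerivAt_posSq (1 - ‖y‖ ^ 2)).comp_hasFDerivAt y h1).const_mul (-(1 / 4))
  have he : eta y • innerSL ℝ y = (-(1 / 4) : ℝ) •
      ((2 * max (1 - ‖y‖ ^ 2) 0) • (-(2 • innerSL ℝ y))) := by
    ext v
    simp [eta]
    ring
  rw [he]
  exact h2

lemma psi_fderiv_single {n : ℕ} (y : E n) (i : Fin n) :
    fderiv ℝ (psi : E n → ℝ) y (EuclideanSpace.single i 1) = eta y * y i := by
  rw [(psi_fderiv y).fderiv]
  simp [EuclideanSpace.inner_single_right]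

/-- The mean value property for globally defined compactly supported functions. -/
lemma mv_global {n : ℕ} (g : E n → ℝ) (hg : ContDiff ℝ 2 g) (hc : HasCompactSupport g)
    (x : E n) (R : ℝ) (hl : ∀ z ∈ ball x R, lap g z = 0) (r : ℝ) (hr : 0 ≤ r) (hrR : r < R) :
    g x * cmass n = ∫ y, g (x + r • y) * eta y := by
  have hg1 : Continuous (fderiv ℝ g) := hg.continuous_fderiv (by norm_num)
  obtain ⟨K, hK⟩ := (hc.fderiv (𝕜 := ℝ)).exists_bound_of_continuous hg1
  have hgc := hg.continuous
  have hec := eta_cont (n := n)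
  have hpc := psi_cont (n := n)
  have hmulη : ∀ f : E n → ℝ, Continuous f → MeasureTheory.Integrable (fun y => f y * eta y) := by
    intro f hf
    exact (hf.mul hec).integrable_of_hasCompactSupport eta_supp.mul_left
  have hmulψ : ∀ f : E n → ℝ, Continuous f → MeasureTheory.Integrable (fun y => f y * psi y) := by
    intro f hf
    exact (hf.mul hpc).integrable_of_hasCompactSupport psi_supp.mul_left
  have hD : ∀ s : ℝ, HasDerivAt (fun r : ℝ => ∫ y, g (x + r • y) * eta y)
      (∫ y, fderiv ℝ g (x + s • y) y * eta y) s := by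
    intro s
    refine (hasDerivAt_integral_of_dominated_loc_of_deriv_le (μ := MeasureTheory.volume)
      (F := fun r y => g (x + r • y) * eta y)
      (F' := fun r y => fderiv ℝ g (x + r • y) y * eta y)
      (bound := fun y => (K * ‖y‖) * eta y) (s := Set.univ) (x₀ := s)
      Filter.univ_mem ?_ ?_ ?_ ?_ ?_ ?_).2
    · filter_upwards with r
      exact (hmulη (fun y => g (x + r • y)) (by fun_prop)).aestronglyMeasurable
    · exact hmulη (fun y => g (x + s • y)) (by fun_prop)
    · exact (hmulη (fun y => fderiv ℝ g (x + s • y) y) (by fun_prop)).aestronglyMeasurable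
    · filter_upwards with y r _
      rw [norm_mul, Real.norm_of_nonneg (eta_nonneg y)]
      gcongr
      · exact eta_nonneg y
      · exact ContinuousLinearMap.le_of_opNorm_le _ (hK _) _
    · exact hmulη (fun y => K * ‖y‖) (by fun_prop)
    · filter_upwards with y r _
      apply HasDerivAt.mul_const
      have h1 : HasDerivAt (fun r : ℝ => x + r • y) y r := by
        simpa using ((hasDerivAt_id r).smul_const y).const_add x
      exact ((hg.differentiable (by norm_num)) _).hasFDerivAt.comp_hasDerivAt r h1
  have hz : ∀ s ∈ Set.Ioo (-R) R, ∫ y, fderiv ℝ g (x + s • y) y * eta y = 0 := by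
    intro s hs
    have e1 : ∀ y : E n, fderiv ℝ g (x + s • y) y * eta y =
        ∑ i, fderiv ℝ g (x + s • y) (EuclideanSpace.single i 1) *
          fderiv ℝ (psi : E n → ℝ) y (EuclideanSpace.single i 1) := by
      intro y
      have hy : y = ∑ i, y i • EuclideanSpace.single i (1 : ℝ) := by
        ext j; simp [Finset.sum_apply, Pi.single_apply]
      conv_lhs => rw [show fderiv ℝ g (x + s • y) y = fderiv ℝ g (x + s • y)
        (∑ i, y i • EuclideanSpace.single i (1 : ℝ)) by rw [← hy]]
      rw [map_sum, Finset.sum_mul]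
      refine Finset.sum_congr rfl fun i _ => ?_
      rw [psi_fderiv_single, map_smul, smul_eq_mul]; ring
    have hdc : ∀ i : Fin n, ContDiff ℝ 1
        (fun z => fderiv ℝ g z (EuclideanSpace.single i 1)) := fun i =>
      (hg.fderiv_right (m := 1) (by norm_num)).clm_apply contDiff_const
    have hfd : ∀ i : Fin n, ∀ y, HasFDerivAt
        (fun y => fderiv ℝ g (x + s • y) (EuclideanSpace.single i 1))
        (s • fderiv ℝ (fun z => fderiv ℝ g z (EuclideanSpace.single i 1)) (x + s • y)) y := by
      intro i y
      have h1 : HasFDerivAt (fun y : E n => x + s • y) (s • ContinuousLinearMap.id ℝ (E n)) y :=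
        ((hasFDerivAt_id y).const_smul s).const_add x
      have := (((hdc i).differentiable (by norm_num)) (x + s • y)).hasFDerivAt.comp y h1
      have he : s • fderiv ℝ (fun z => fderiv ℝ g z (EuclideanSpace.single i 1)) (x + s • y) =
          (fderiv ℝ (fun z => fderiv ℝ g z (EuclideanSpace.single i 1)) (x + s • y)).comp
            (s • ContinuousLinearMap.id ℝ (E n)) := by
        ext v; simp
      rw [he]
      exact this
    have hsec : ∀ i : Fin n, Continuous fun y : E n =>
        fderiv ℝ (fun z => fderiv ℝ g z (EuclideanSpace.single i 1)) (x + s • y)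
          (EuclideanSpace.single i 1) := by
      intro i
      have := (hdc i).continuous_fderiv (by norm_num)
      fun_prop
    have i1 : ∀ i : Fin n, MeasureTheory.Integrable
        (fun y => fderiv ℝ g (x + s • y) (EuclideanSpace.single i 1) *
          fderiv ℝ (psi : E n → ℝ) y (EuclideanSpace.single i 1)) := by
      intro i
      have := hmulη (fun y => fderiv ℝ g (x + s • y) (EuclideanSpace.single i 1) * y i)
        (by fun_prop)
      refine this.congr ?_
      filter_upwards with y
      rw [psi_fderiv_single]; ring
    have i2 : ∀ i : Fin n, MeasureTheory.Integrable
        (fun y => fderiv ℝ (fun z => fderiv ℝ g z (EuclideanSpace.single i 1)) (x + s • y)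
          (EuclideanSpace.single i 1) * psi y) := fun i => hmulψ _ (hsec i)
    have ibp : ∀ i : Fin n, ∫ y, fderiv ℝ g (x + s • y) (EuclideanSpace.single i 1) *
          fderiv ℝ (psi : E n → ℝ) y (EuclideanSpace.single i 1) =
        - ∫ y, s * (fderiv ℝ (fun z => fderiv ℝ g z (EuclideanSpace.single i 1)) (x + s • y)
          (EuclideanSpace.single i 1) * psi y) := by
      intro i
      rw [integral_mul_fderiv_eq_neg_fderiv_mul_of_integrable]
      · congr 1
        refine MeasureTheory.integral_congr_ae ?_
        filter_upwards with y
        rw [(hfd i y).fderiv]; simp; ring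
      · refine ((i2 i).const_mul s).congr ?_
        filter_upwards with y
        rw [(hfd i y).fderiv]; simp; ring
      · exact i1 i
      · exact hmulψ _ (by fun_prop)
      · exact fun y _ => (hfd i y).differentiableAt
      · exact fun y _ => (psi_fderiv y).differentiableAt
    simp_rw [e1]
    rw [MeasureTheory.integral_finsetSum _ (fun i _ => i1 i)]
    simp_rw [ibp]
    rw [Finset.sum_neg_distrib, ← MeasureTheory.integral_finsetSum _
      (fun i _ => (i2 i).const_mul s), neg_eq_zero]
    apply MeasureTheory.integral_eq_zero_of_ae
    filter_upwards with y
    rw [← Finset.mul_sum, ← Finset.sum_mul]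
    by_cases hy : ‖y‖ < 1
    · have hm : x + s • y ∈ ball x R := by
        rw [mem_ball, dist_eq_norm, add_sub_cancel_left, norm_smul, Real.norm_eq_abs]
        have : |s| < R := abs_lt.2 hs
        nlinarith [abs_nonneg s, norm_nonneg y]
      have := hl _ hm
      unfold lap at this
      rw [this]; simp
    · have : eta y = 0 := eta_zero_of (not_lt.1 hy)
      simp [psi, this]
  have hcst := isOpen_Ioo.is_const_of_deriv_eq_zero (s := Set.Ioo (-R) R) isPreconnected_Ioo
    (f := fun r : ℝ => ∫ y, g (x + r • y) * eta y)
    (fun s _ => (hD s).differentiableAt.differentiableWithinAt)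
    (fun s hs => by rw [(hD s).deriv, hz s hs]; rfl) (x := 0) (y := r)
    ⟨by linarith, by linarith⟩ ⟨by linarith, hrR⟩
  rw [← hcst]
  simp [MeasureTheory.integral_const_mul, cmass]

/-- The weighted mean value property on `U`. -/
def MVOn {n : ℕ} (U : Set (E n)) (w : E n → ℝ) : Prop :=
  ContinuousOn w U ∧ ∀ (x : E n) (r : ℝ), 0 ≤ r → closedBall x r ⊆ U →
    w x * cmass n = ∫ y, w (x + r • y) * eta y

lemma lap_congr {n : ℕ} {f g : E n → ℝ} {x : E n} (h : f =ᶠ[𝓝 x] g) : lap f x = lap g x := by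
  unfold lap
  refine Finset.sum_congr rfl fun i _ => ?_
  have : (fun y => fderiv ℝ f y (EuclideanSpace.single i 1)) =ᶠ[𝓝 x]
      (fun y => fderiv ℝ g y (EuclideanSpace.single i 1)) := by
    filter_upwards [h.fderiv (𝕜 := ℝ)] with y hy
    rw [hy]
  rw [this.fderiv_eq]

lemma HarmOn.mvOn {n : ℕ} {U : Set (E n)} (hU : IsOpen U) {w : E n → ℝ} (hw : HarmOn U w) :
    MVOn U w := by
  refine ⟨hw.1.continuousOn, fun x r hr hsub => ?_⟩
  obtain ⟨δ, hδ, hδU⟩ := (isCompact_closedBall x r).exists_cthickening_subset_open hU hsub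
  rw [cthickening_closedBall hδ.le hr] at hδU
  let b : ContDiffBump x := ⟨r + δ / 2, r + δ, by linarith, by linarith⟩
  let g : E n → ℝ := fun y => b y * w y
  have hgw : ∀ y ∈ ball x (r + δ / 2), g y = w y := by
    intro y hy
    have : b y = 1 := b.one_of_mem_closedBall (ball_subset_closedBall hy)
    simp [g, this]
  have hts : tsupport b = closedBall x (r + δ) := b.tsupport_eq
  have hg : ContDiff ℝ 2 g := by
    rw [contDiff_iff_contDiffAt]
    intro y
    by_cases hy : y ∈ U
    · exact b.contDiffAt.mul (hw.1.contDiffAt (hU.mem_nhds hy))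
    · have hy' : y ∉ tsupport b := by
        rw [hts]; intro h; exact hy (hδU (by rwa [add_comm]))
      have : g =ᶠ[𝓝 y] fun _ => 0 := by
        have := notMem_tsupport_iff_eventuallyEq.1 hy'
        filter_upwards [this] with z hz
        simp [g, hz]
      exact contDiffAt_const.congr_of_eventuallyEq this
  have hgc : HasCompactSupport g := b.hasCompactSupport.mul_right
  have hl : ∀ z ∈ ball x (r + δ / 2), lap g z = 0 := by
    intro z hz
    rw [lap_congr (g := w)]
    · apply hw.2
      apply hδU
      rw [mem_closedBall]
      rw [mem_ball] at hz
      linarith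
    · filter_upwards [isOpen_ball.mem_nhds hz] with y hy using hgw y hy
  have := mv_global g hg hgc x (r + δ / 2) hl r hr (by linarith)
  rw [hgw x (mem_ball_self (by linarith))] at this
  rw [this]
  refine MeasureTheory.integral_congr_ae ?_
  filter_upwards with y
  by_cases hy : ‖y‖ < 1
  · rw [hgw]
    rw [mem_ball, dist_eq_norm, add_sub_cancel_left, norm_smul, Real.norm_of_nonneg hr]
    nlinarith [norm_nonneg y]
  · simp [eta_zero_of (not_lt.1 hy)]

lemma MVOn.integrable {n : ℕ} {U : Set (E n)} {w : E n → ℝ} (hw : ContinuousOn w U)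
    {x : E n} {r : ℝ} (hr : 0 ≤ r) (h : closedBall x r ⊆ U) :
    MeasureTheory.Integrable (fun y => w (x + r • y) * eta y) := by
  have hsupp : Function.support (fun y => w (x + r • y) * eta y) ⊆ closedBall (0 : E n) 1 := by
    intro y hy
    rw [mem_closedBall_zero_iff]
    by_contra hc
    apply hy
    simp [eta_zero_of (not_le.1 hc).le]
  rw [← MeasureTheory.integrableOn_iff_integrable_of_support_subset hsupp]
  apply ContinuousOn.integrableOn_compact (isCompact_closedBall _ _)
  refine ContinuousOn.mul ?_ eta_cont.continuousOn
  refine hw.comp (by fun_prop) ?_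
  intro y hy
  apply h
  rw [mem_closedBall_zero_iff] at hy
  rw [mem_closedBall, dist_eq_norm, add_sub_cancel_left, norm_smul, Real.norm_of_nonneg hr]
  nlinarith [norm_nonneg y]

lemma eta_lip {n : ℕ} {a b : E n} (ha : ‖a‖ ≤ 5) (hb : ‖b‖ ≤ 5) :
    |eta a - eta b| ≤ 10 * ‖a - b‖ := by
  unfold eta
  refine (abs_max_sub_max_le_abs _ _ _).trans ?_
  have h1 : (1 - ‖a‖ ^ 2) - (1 - ‖b‖ ^ 2) = (‖b‖ - ‖a‖) * (‖a‖ + ‖b‖) := by ring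
  rw [h1, abs_mul, abs_of_nonneg (add_nonneg (norm_nonneg a) (norm_nonneg b))]
  have h2 : |‖b‖ - ‖a‖| ≤ ‖a - b‖ := by
    rw [norm_sub_rev]; exact abs_norm_sub_norm_le b a
  have := abs_nonneg (‖b‖ - ‖a‖)
  have := norm_nonneg a
  have := norm_nonneg b
  nlinarith

/-- One step of the difference estimate. -/
lemma mv_step (n : ℕ) : ∃ C : ℝ, 0 < C ∧ ∀ (w : E n → ℝ) (x h : E n) (r M : ℝ), 0 < r →
    MVOn (ball x r) w → (∀ y ∈ ball x r, |w y| ≤ M) → ‖h‖ ≤ r / 2 →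
    |w (x + h) - w x| ≤ C * (‖h‖ / r) * M := by
  set V : ℝ := MeasureTheory.volume.real (closedBall (0 : E n) 3) with hV
  have hcm := cmass_pos n
  have hVn : 0 ≤ V := MeasureTheory.measureReal_nonneg
  refine ⟨30 * V / cmass n + 1, by positivity, ?_⟩
  intro w x h r M hr hw hM hh
  have hM0 : 0 ≤ M := (abs_nonneg _).trans (hM x (mem_ball_self hr))
  set s : ℝ := r / 3 with hs
  have hs0 : 0 < s := by positivity
  have sub1 : closedBall x s ⊆ ball x r := closedBall_subset_ball (by linarith)
  have sub2 : closedBall (x + h) s ⊆ ball x r := by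
    intro z hz
    rw [mem_closedBall, dist_eq_norm] at hz
    rw [mem_ball, dist_eq_norm]
    calc ‖z - x‖ = ‖(z - (x + h)) + h‖ := by congr 1; abel
      _ ≤ ‖z - (x + h)‖ + ‖h‖ := norm_add_le _ _
      _ < r := by linarith
  have e1 := hw.2 x s hs0.le sub1
  have e2 := hw.2 (x + h) s hs0.le sub2
  have j1 := MVOn.integrable hw.1 hs0.le sub1
  have j2 := MVOn.integrable hw.1 hs0.le sub2
  set k : E n := s⁻¹ • h with hk
  have hsk : s • k = h := by rw [hk, smul_smul, mul_inv_cancel₀ hs0.ne', one_smul]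
  have hkn : ‖k‖ = 3 * (‖h‖ / r) := by
    rw [hk, norm_smul, norm_inv, Real.norm_of_nonneg hs0.le, hs]; field_simp
  have hk2 : ‖k‖ ≤ 3 / 2 := by
    rw [hkn]
    have : ‖h‖ / r ≤ 1 / 2 := by rw [div_le_iff₀ hr]; linarith
    linarith
  have hfun : (fun y => w (x + s • y) * eta (y - k)) =
      fun y => (fun y => w (x + h + s • y) * eta y) (y - k) := by
    funext y
    simp only [smul_sub, hsk]
    congr 2; abel
  have j3 : MeasureTheory.Integrable (fun y => w (x + s • y) * eta (y - k)) := by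
    rw [hfun]; exact j2.comp_sub_right k
  have e3 : ∫ y, w (x + h + s • y) * eta y = ∫ y, w (x + s • y) * eta (y - k) := by
    rw [hfun, MeasureTheory.integral_sub_right_eq_self (fun y => w (x + h + s • y) * eta y) k]
  have e4 : (w (x + h) - w x) * cmass n =
      ∫ y, (w (x + s • y) * eta (y - k) - w (x + s • y) * eta y) := by
    rw [MeasureTheory.integral_sub j3 j1, ← e3, ← e1, ← e2]; ring
  have bd : ‖∫ y, (w (x + s • y) * eta (y - k) - w (x + s • y) * eta y)‖ ≤
      ∫ y, (closedBall (0 : E n) 3).indicator (fun _ => M * (10 * ‖k‖)) y := by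
    apply MeasureTheory.norm_integral_le_of_norm_le
    · rw [MeasureTheory.integrable_indicator_iff measurableSet_closedBall]
      exact continuousOn_const.integrableOn_compact (isCompact_closedBall _ _)
    · filter_upwards with y
      by_cases hy : ‖y‖ < 1 ∨ ‖y - k‖ < 1
      · have hy3 : ‖y‖ ≤ 5 / 2 := by
          rcases hy with hy | hy
          · linarith
          · have : ‖y‖ ≤ ‖y - k‖ + ‖k‖ := by simpa using norm_add_le (y - k) k
            linarith
        have hmem : x + s • y ∈ ball x r := by
          rw [mem_ball, dist_eq_norm, add_sub_cancel_left, norm_smul, Real.norm_of_nonneg hs0.le]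
          nlinarith [norm_nonneg y]
        rw [Set.indicator_of_mem (by rw [mem_closedBall_zero_iff]; linarith), ← mul_sub, norm_mul]
        have hyk : ‖y - k‖ ≤ 5 := (norm_sub_le _ _).trans (by linarith)
        have := eta_lip hyk (show ‖y‖ ≤ 5 by linarith)
        rw [sub_sub_cancel_left, norm_neg] at this
        exact mul_le_mul (hM _ hmem) this (norm_nonneg _) hM0
      · rw [not_or, not_lt, not_lt] at hy
        rw [eta_zero_of hy.1, eta_zero_of hy.2]
        simp only [mul_zero, sub_zero, norm_zero]
        apply Set.indicator_nonneg
        intro _ _; positivity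
  rw [MeasureTheory.integral_indicator measurableSet_closedBall, MeasureTheory.setIntegral_const,
    ← e4, norm_mul, Real.norm_of_nonneg hcm.le, smul_eq_mul, ← hV, hkn] at bd
  rw [Real.norm_eq_abs, ← le_div_iff₀ hcm] at bd
  refine bd.trans ?_
  have h5 : V * (M * (10 * (3 * (‖h‖ / r)))) / cmass n
      = (30 * V / cmass n) * (‖h‖ / r) * M := by ring
  rw [h5]
  have : 0 ≤ (‖h‖ / r) * M := by positivity
  nlinarith

lemma MVOn.mono {n : ℕ} {U V : Set (E n)} {w : E n → ℝ} (hw : MVOn U w) (h : V ⊆ U) :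
    MVOn V w := ⟨hw.1.mono h, fun x r hr hs => hw.2 x r hr (hs.trans h)⟩

lemma MVOn.diff {n : ℕ} {U V : Set (E n)} {w : E n → ℝ} {h : E n} (hw : MVOn U w) (h1 : V ⊆ U)
    (h2 : ∀ y ∈ V, y + h ∈ U) : MVOn V (fwdDiff h w) := by
  constructor
  · have : ContinuousOn (fun y => w (y + h)) V :=
      hw.1.comp (by fun_prop) h2
    exact this.sub (hw.1.mono h1)
  · intro x r hr hs
    have s1 : closedBall x r ⊆ U := hs.trans h1
    have s2 : closedBall (x + h) r ⊆ U := by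
      intro z hz
      have := h2 (z - h) (hs (by
        rw [mem_closedBall, dist_eq_norm] at hz ⊢
        rwa [sub_sub, add_comm h x]))
      simpa using this
    have e1 := hw.2 x r hr s1
    have e2 := hw.2 (x + h) r hr s2
    have j1 := MVOn.integrable hw.1 hr s1
    have j2 := MVOn.integrable hw.1 hr s2
    rw [fwdDiff, sub_mul, e1, e2, ← MeasureTheory.integral_sub j2 j1]
    refine MeasureTheory.integral_congr_ae ?_
    filter_upwards with y
    simp only [fwdDiff]
    rw [← sub_mul, add_right_comm]

lemma mv_iter (n : ℕ) : ∃ C : ℝ, 0 < C ∧ ∀ (k : ℕ) (w : E n → ℝ) (x h : E n) (r M : ℝ), 0 < r →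
    MVOn (ball x ((k : ℝ) * r)) w → (∀ y ∈ ball x ((k : ℝ) * r), |w y| ≤ M) → |w x| ≤ M →
    ‖h‖ ≤ r / 2 → |((fwdDiff h)^[k] w) x| ≤ (C * (‖h‖ / r)) ^ k * M := by
  obtain ⟨C, hC, H⟩ := mv_step n
  refine ⟨C, hC, ?_⟩
  intro k
  induction k with
  | zero => intro w x h r M hr _ _ hx _; simpa using hx
  | succ k ih =>
    intro w x h r M hr hw hM hx hh
    rw [Function.iterate_succ_apply]
    have key : ∀ y, dist y x ≤ k * r → |fwdDiff h w y| ≤ C * (‖h‖ / r) * M := by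
      intro y hy
      have hsub : ball y r ⊆ ball x (((k + 1 : ℕ) : ℝ) * r) := by
        apply ball_subset_ball'
        push_cast; linarith
      exact H w y h r M hr (hw.mono hsub) (fun z hz => hM z (hsub hz)) hh
    have hkr : (0 : ℝ) ≤ k * r := by positivity
    have := ih (fwdDiff h w) x h r (C * (‖h‖ / r) * M) hr ?_ ?_ ?_ hh
    · refine this.trans (le_of_eq ?_)
      ring
    · apply hw.diff
      · apply ball_subset_ball; push_cast; linarith
      · intro y hy
        rw [mem_ball, dist_eq_norm] at hy ⊢
        have : ‖y + h - x‖ ≤ ‖y - x‖ + ‖h‖ := by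
          rw [show y + h - x = (y - x) + h by abel]; exact norm_add_le _ _
        push_cast; linarith
    · intro y hy; exact key y (le_of_lt (mem_ball.1 hy))
    · apply key; simpa using hkr

/-- Quantitative propagation of zeros. -/
lemma mv_prop (n : ℕ) : ∃ κ : ℝ, 0 < κ ∧ ∀ (w : E n → ℝ) (z d : E n) (ρ M : ℝ), 0 < ρ →
    MVOn (ball z ρ) w → (∀ y ∈ ball z ρ, |w y| ≤ M) → (∀ᶠ y in 𝓝 z, w y = 0) →
    ‖d‖ ≤ κ * ρ → w (z + d) = 0 := by
  obtain ⟨C, hC, H⟩ := mv_iter n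
  have he := Real.exp_pos 1
  refine ⟨min (1 / 2) (1 / (2 * Real.exp 1 * C)), by positivity, ?_⟩
  intro w z d ρ M hρ hw hM hz hd
  have hd1 : ‖d‖ ≤ ρ / 2 := by
    refine hd.trans ?_
    have := min_le_left (1 / 2 : ℝ) (1 / (2 * Real.exp 1 * C))
    nlinarith
  have hd2 : Real.exp 1 * C * (‖d‖ / ρ) ≤ 1 / 2 := by
    have : ‖d‖ / ρ ≤ 1 / (2 * Real.exp 1 * C) := by
      rw [div_le_iff₀ hρ]
      exact hd.trans (by gcongr; exact min_le_right _ _)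
    calc Real.exp 1 * C * (‖d‖ / ρ) ≤ Real.exp 1 * C * (1 / (2 * Real.exp 1 * C)) := by gcongr
      _ = 1 / 2 := by field_simp
  have hM0 : 0 ≤ M := (abs_nonneg _).trans (hM z (mem_ball_self hρ))
  obtain ⟨t, ht, htz⟩ := Metric.eventually_nhds_iff.1 hz
  have main : ∀ m : ℕ, |w (z + d)| ≤ 2 * M * (1 / 2) ^ m := by
    intro m
    obtain ⟨N, hN⟩ := exists_nat_gt (m * ‖d‖ / t)
    have hN0 : (0 : ℝ) < N := lt_of_le_of_lt (by positivity) hN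
    have hNn : (N : ℝ) ≠ 0 := hN0.ne'
    set h : E n := (N : ℝ)⁻¹ • d with hh
    have hhn : ‖h‖ = ‖d‖ / N := by
      rw [hh, norm_smul, norm_inv, Real.norm_of_nonneg hN0.le]; field_simp
    have hNh : z + d = z + N • h := by
      rw [hh, ← Nat.cast_smul_eq_nsmul ℝ, smul_smul, mul_inv_cancel₀ hNn, one_smul]
    have small : ∀ k ≤ m, (fwdDiff h)^[k] w z = 0 := by
      intro k hk
      rw [fwdDiff_iter_eq_sum_shift]
      apply Finset.sum_eq_zero
      intro j hj
      have hjm : (j : ℝ) ≤ m := by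
        have : j < k + 1 := Finset.mem_range.1 hj
        exact_mod_cast (by omega : j ≤ m)
      rw [htz, smul_zero]
      rw [dist_eq_norm, add_sub_cancel_left, ← Nat.cast_smul_eq_nsmul ℝ, norm_smul, hhn,
        Real.norm_of_nonneg (Nat.cast_nonneg j)]
      rw [div_lt_iff₀ ht] at hN
      rw [mul_div_assoc', div_lt_iff₀ hN0]
      calc (j : ℝ) * ‖d‖ ≤ m * ‖d‖ := by gcongr
        _ < t * N := by linarith
    have term : ∀ k ≤ N, |N.choose k • (fwdDiff h)^[k] w z| ≤ (1 / 2) ^ k * M := by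
      intro k hk
      rcases Nat.eq_zero_or_pos k with rfl | hk0
      · simpa using hM z (mem_ball_self hρ)
      have hk0' : (0 : ℝ) < k := by exact_mod_cast hk0
      have hkr : (k : ℝ) * (ρ / k) = ρ := by field_simp
      have hkN : (k : ℝ) ≤ N := by exact_mod_cast hk
      have := H k w z h (ρ / k) M (by positivity) (by rwa [hkr]) (by rwa [hkr])
        (hM z (mem_ball_self hρ)) (by
          rw [hhn]
          calc ‖d‖ / N ≤ (ρ / 2) / k := by gcongr
            _ = ρ / k / 2 := by ring)
      rw [nsmul_eq_mul, abs_mul, Nat.abs_cast]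
      have hch : ((N.choose k : ℕ) : ℝ) ≤ (N : ℝ) ^ k / (k.factorial : ℝ) := Nat.choose_le_pow_div k N
      have hexp : (k : ℝ) ^ k / (k.factorial : ℝ) ≤ Real.exp k :=
        Real.pow_div_factorial_le_exp k hk0'.le k
      calc (N.choose k : ℝ) * |(fwdDiff h)^[k] w z|
          ≤ ((N : ℝ) ^ k / (k.factorial : ℝ)) * ((C * (‖h‖ / (ρ / k))) ^ k * M) := by gcongr
        _ = ((k : ℝ) ^ k / (k.factorial : ℝ)) * ((C * (‖d‖ / ρ)) ^ k * M) := by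
            have e : C * (‖h‖ / (ρ / k)) = (k : ℝ) * (N : ℝ)⁻¹ * (C * (‖d‖ / ρ)) := by
              rw [hhn]; field_simp
            rw [e, mul_pow, mul_pow, inv_pow]
            field_simp
        _ ≤ Real.exp k * ((C * (‖d‖ / ρ)) ^ k * M) := by gcongr
        _ = (Real.exp 1 * C * (‖d‖ / ρ)) ^ k * M := by
            rw [mul_assoc (Real.exp 1), mul_pow (Real.exp 1), ← Real.exp_nat_mul, mul_one]; ring
        _ ≤ (1 / 2) ^ k * M := by gcongr
    rw [hNh, shift_eq_sum_fwdDiff_iter h w N z]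
    refine (Finset.abs_sum_le_sum_abs _ _).trans ?_
    have hb : ∀ k ∈ Finset.range (N + 1), |N.choose k • (fwdDiff h)^[k] w z| ≤
        if k < m then 0 else (1 / 2 : ℝ) ^ k * M := by
      intro k hk
      split_ifs with hkm
      · rw [small k hkm.le]; simp
      · exact term k (by have := Finset.mem_range.1 hk; omega)
    refine (Finset.sum_le_sum hb).trans ?_
    have hgeo : ∀ L : ℕ, ∑ k ∈ Finset.range L, (if k < m then 0 else (1 / 2 : ℝ) ^ k * M) ≤
        2 * M * (1 / 2) ^ m - (if L ≤ m then 0 else 2 * M * (1 / 2) ^ L) := by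
      intro L
      induction L with
      | zero => simp; positivity
      | succ L ih =>
        rw [Finset.sum_range_succ]
        rcases lt_trichotomy L m with h | h | h
        · rw [if_pos h, if_pos (by omega)]; rw [if_pos h.le] at ih; linarith
        · rw [if_neg (by omega), if_neg (by omega)]; rw [if_pos h.le] at ih
          have : ∑ k ∈ Finset.range L, (if k < m then 0 else (1 / 2 : ℝ) ^ k * M) = 0 := by
            apply Finset.sum_eq_zero
            intro k hk
            rw [if_pos (by have := Finset.mem_range.1 hk; omega)]
          rw [this, ← h, pow_succ]; linarith
        · rw [if_neg (by omega), if_neg (by omega)]; rw [if_neg (by omega)] at ih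
          rw [pow_succ]; linarith
    refine (hgeo (N + 1)).trans ?_
    have : 0 ≤ (if N + 1 ≤ m then 0 else 2 * M * (1 / 2 : ℝ) ^ (N + 1)) := by
      split_ifs <;> positivity
    linarith
  have hlim : Tendsto (fun m : ℕ => 2 * M * (1 / 2 : ℝ) ^ m) atTop (𝓝 (2 * M * 0)) :=
    (tendsto_pow_atTop_nhds_zero_of_lt_one (by norm_num) (by norm_num)).const_mul _
  have := ge_of_tendsto' hlim main
  rw [mul_zero] at this
  exact abs_eq_zero.1 (le_antisymm this (abs_nonneg _))

/-- Unique continuation for harmonic functions. -/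
lemma harm_uc {n : ℕ} {U : Set (E n)} (hU : IsOpen U) (hUc : IsPreconnected U) {w : E n → ℝ}
    (hw : HarmOn U w) {x₀ : E n} (hx₀ : x₀ ∈ U) (h0 : ∀ᶠ y in 𝓝 x₀, w y = 0) :
    ∀ x ∈ U, w x = 0 := by
  obtain ⟨κ, hκ, H⟩ := mv_prop n
  have hmv := hw.mvOn hU
  let Z : Set (E n) := {x | ∀ᶠ y in 𝓝 x, w y = 0}
  have hZ : IsOpen Z := isOpen_iff_mem_nhds.2 fun x hx => hx.eventually_nhds
  have hsub : U ⊆ Z := by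
    apply hUc.subset_of_closure_inter_subset hZ ⟨x₀, hx₀, h0⟩
    rintro x ⟨hxc, hxU⟩
    obtain ⟨R, hR, hRU⟩ := Metric.nhds_basis_closedBall.mem_iff.1 (hU.mem_nhds hxU)
    obtain ⟨M, hM⟩ := (isCompact_closedBall x R).exists_bound_of_continuousOn (hmv.1.mono hRU)
    set δ : ℝ := min (R / 2) (κ * (R / 2) / 2) with hδ
    have hδ0 : 0 < δ := by positivity
    obtain ⟨z, hzZ, hzx⟩ := Metric.mem_closure_iff.1 hxc δ hδ0
    have hzx' : dist z x < δ := by rwa [dist_comm]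
    have hδR : δ ≤ R / 2 := min_le_left _ _
    have hδκ : δ ≤ κ * (R / 2) / 2 := min_le_right _ _
    have hs : ball z (R / 2) ⊆ closedBall x R := by
      intro y hy
      rw [mem_ball] at hy
      rw [mem_closedBall]
      linarith [dist_triangle y z x]
    show ∀ᶠ y in 𝓝 x, w y = 0
    filter_upwards [ball_mem_nhds x hδ0] with y hy
    have := H w z (y - z) (R / 2) M (by positivity) (hmv.mono (hs.trans hRU))
      (fun y hy => hM y (hs hy)) hzZ (by
        rw [← dist_eq_norm]
        rw [mem_ball] at hy
        linarith [dist_triangle y x z])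
    simpa using this
  intro x hx
  exact (hsub hx).self_of_nhds

lemma HarmOn.fderiv_diff {n : ℕ} {U : Set (E n)} (hU : IsOpen U) {u : E n → ℝ} (hu : HarmOn U u)
    {x : E n} (hx : x ∈ U) : DifferentiableAt ℝ (fderiv ℝ u) x :=
  ((hu.1.contDiffAt (hU.mem_nhds hx)).fderiv_right (m := 1) (by norm_num)).differentiableAt
    (by norm_num)

lemma HarmOn.diffAt {n : ℕ} {U : Set (E n)} (hU : IsOpen U) {u : E n → ℝ} (hu : HarmOn U u)
    {x : E n} (hx : x ∈ U) : DifferentiableAt ℝ u x :=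
  (hu.1.contDiffAt (hU.mem_nhds hx)).differentiableAt (by norm_num)

lemma lap_eq {n : ℕ} {u : E n → ℝ} {x : E n} (h : DifferentiableAt ℝ (fderiv ℝ u) x) :
    lap u x = ∑ i, fderiv ℝ (fderiv ℝ u) x (EuclideanSpace.single i 1)
      (EuclideanSpace.single i 1) := by
  unfold lap
  refine Finset.sum_congr rfl fun i _ => ?_
  rw [fderiv_clm_apply h (differentiableAt_const _)]
  simp

lemma HarmOn.comb {n : ℕ} {U : Set (E n)} (hU : IsOpen U) {u v : E n → ℝ} (hu : HarmOn U u)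
    (hv : HarmOn U v) (l c : ℝ) : HarmOn U (fun x => v x - l * u x - c) := by
  refine ⟨(hv.1.sub (contDiffOn_const.mul hu.1)).sub contDiffOn_const, fun x hx => ?_⟩
  have he : fderiv ℝ (fun x => v x - l * u x - c) =ᶠ[𝓝 x]
      fun y => fderiv ℝ v y - l • fderiv ℝ u y := by
    filter_upwards [hU.mem_nhds hx] with y hy
    exact (((hv.diffAt hU hy).hasFDerivAt.sub
      ((hu.diffAt hU hy).hasFDerivAt.const_mul l)).sub_const c).fderiv
  have hdu := hu.fderiv_diff hU hx
  have hdv := hv.fderiv_diff hU hx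
  have hd := hdv.hasFDerivAt.sub (hdu.hasFDerivAt.const_smul l)
  have hd' := hd.congr_of_eventuallyEq he
  have h1 := hu.2 x hx
  have h2 := hv.2 x hx
  rw [lap_eq hdu] at h1
  rw [lap_eq hdv] at h2
  rw [lap_eq hd'.differentiableAt, hd'.fderiv]
  simp only [ContinuousLinearMap.sub_apply, ContinuousLinearMap.smul_apply, Finset.sum_sub_distrib,
    h2, smul_eq_mul, ← Finset.mul_sum, h1]
  simp

/-- If `∇v = lam • ∇u` near `x` and `∇u(x) ≠ 0`, then `∇lam(x) = 0`. -/
lemma lam_fderiv {n : ℕ} {U : Set (E n)} (hU : IsOpen U) {u v lam : E n → ℝ} (hu : HarmOn U u)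
    (hv : HarmOn U v) {x : E n} (hx : x ∈ U) (hl : DifferentiableAt ℝ lam x)
    (he : ∀ᶠ y in 𝓝 x, fderiv ℝ v y = lam y • fderiv ℝ u y) (j : Fin n)
    (hj : fderiv ℝ u x (EuclideanSpace.single j 1) ≠ 0) : fderiv ℝ lam x = 0 := by
  have hdu := hu.fderiv_diff hU hx
  have hdv := hv.fderiv_diff hU hx
  have hD : ∀ a b, fderiv ℝ (fderiv ℝ v) x a b =
      lam x * fderiv ℝ (fderiv ℝ u) x a b + fderiv ℝ lam x a * fderiv ℝ u x b := by
    intro a b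
    have := (hl.hasFDerivAt.smul hdu.hasFDerivAt).congr_of_eventuallyEq he
    rw [this.fderiv]
    simp
  have su : ∀ a b, fderiv ℝ (fderiv ℝ u) x a b = fderiv ℝ (fderiv ℝ u) x b a :=
    (hu.1.contDiffAt (hU.mem_nhds hx)).isSymmSndFDerivAt (by simp)
  have sv : ∀ a b, fderiv ℝ (fderiv ℝ v) x a b = fderiv ℝ (fderiv ℝ v) x b a :=
    (hv.1.contDiffAt (hU.mem_nhds hx)).isSymmSndFDerivAt (by simp)
  have hsym : ∀ a b, fderiv ℝ lam x a * fderiv ℝ u x b = fderiv ℝ lam x b * fderiv ℝ u x a := by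
    intro a b
    have h1 := hD a b
    have h2 := hD b a
    rw [sv, su] at h1
    linarith
  have htr : ∑ i, fderiv ℝ lam x (EuclideanSpace.single i 1) *
      fderiv ℝ u x (EuclideanSpace.single i 1) = 0 := by
    have h1 := hu.2 x hx
    have h2 := hv.2 x hx
    rw [lap_eq hdu] at h1
    rw [lap_eq hdv] at h2
    simp_rw [hD] at h2
    rw [Finset.sum_add_distrib, ← Finset.mul_sum, h1] at h2
    simpa using h2
  have hLj : fderiv ℝ lam x (EuclideanSpace.single j 1) = 0 := by
    have h1 : fderiv ℝ lam x (EuclideanSpace.single j 1) *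
        ∑ i, (fderiv ℝ u x (EuclideanSpace.single i 1)) ^ 2 = 0 := by
      rw [Finset.mul_sum]
      calc _ = ∑ i, fderiv ℝ u x (EuclideanSpace.single j 1) *
            (fderiv ℝ lam x (EuclideanSpace.single i 1) *
              fderiv ℝ u x (EuclideanSpace.single i 1)) := by
            refine Finset.sum_congr rfl fun i _ => ?_
            have := hsym (EuclideanSpace.single j 1) (EuclideanSpace.single i 1)
            rw [pow_two, ← mul_assoc, this]; ring
        _ = 0 := by rw [← Finset.mul_sum, htr, mul_zero]
    rcases mul_eq_zero.1 h1 with h | h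
    · exact h
    · exfalso
      have := (Finset.sum_eq_zero_iff_of_nonneg (fun i _ => sq_nonneg _)).1 h j (Finset.mem_univ j)
      exact hj (by simpa using this)
  ext a
  have := hsym a (EuclideanSpace.single j 1)
  rw [hLj, zero_mul] at this
  simpa [hj] using this

lemma exists_single {n : ℕ} {L : E n →L[ℝ] ℝ} (hL : L ≠ 0) :
    ∃ j, L (EuclideanSpace.single j 1) ≠ 0 := by
  by_contra hc
  push Not at hc
  apply hL
  ext y
  have hy : y = ∑ i, y i • EuclideanSpace.single i (1 : ℝ) := by
    ext j; simp [Finset.sum_apply, Pi.single_apply]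
  rw [hy, map_sum]
  simp [hc]

/-- **Degenerate harmonic maps.** If `F : U → ℝ²` is a harmonic map on a domain `U ⊆ ℝⁿ`
whose total derivative has rank at most one everywhere, then `F(U)` is contained in an
affine line of `ℝ²`. -/
theorem stmt19 {n : ℕ} (U : Set (E n)) (hUo : IsOpen U) (hUc : IsConnected U)
    (F : E n → E 2) (hF : ∀ i, HarmOn U (fun x => F x i))
    (hrank : ∀ x ∈ U,
      Module.finrank ℝ (LinearMap.range ((fderiv ℝ F x : E n →L[ℝ] E 2) : E n →ₗ[ℝ] E 2)) ≤ 1) :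
    ∃ a v : E 2, v ≠ 0 ∧ ∀ x ∈ U, ∃ t : ℝ, F x = a + t • v := by
  have hu := hF 0
  have hv := hF 1
  have hpar : ∀ x ∈ U, ∀ a b, fderiv ℝ (fun x => F x 0) x a * fderiv ℝ (fun x => F x 1) x b =
      fderiv ℝ (fun x => F x 1) x a * fderiv ℝ (fun x => F x 0) x b := by
    intro x hx a b
    have hdF : DifferentiableAt ℝ F x :=
      differentiableAt_euclidean.2 fun i => (hF i).diffAt hUo hx
    have hcomp : ∀ i a, fderiv ℝ (fun x => F x i) x a = (fderiv ℝ F x a) i := by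
      intro i a
      have := ((EuclideanSpace.proj i : E 2 →L[ℝ] ℝ).hasFDerivAt (x := F x)).comp x hdF.hasFDerivAt
      have h2 : HasFDerivAt (fun x => F x i)
        ((EuclideanSpace.proj i : E 2 →L[ℝ] ℝ).comp (fderiv ℝ F x)) x := this
      rw [h2.fderiv]
      rfl
    obtain ⟨v, hv⟩ := finrank_le_one_iff.1 (hrank x hx)
    obtain ⟨ca, hca⟩ := hv ⟨fderiv ℝ F x a, ⟨a, rfl⟩⟩
    obtain ⟨cb, hcb⟩ := hv ⟨fderiv ℝ F x b, ⟨b, rfl⟩⟩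
    have ha : ca • (v : E 2) = fderiv ℝ F x a := congrArg Subtype.val hca
    have hb : cb • (v : E 2) = fderiv ℝ F x b := congrArg Subtype.val hcb
    rw [hcomp, hcomp, hcomp, hcomp, ← ha, ← hb]
    simp only [PiLp.smul_apply, smul_eq_mul]
    ring
  by_cases hz : ∀ x ∈ U, fderiv ℝ (fun x => F x 0) x = 0
  · obtain ⟨c, hc⟩ := hUo.exists_is_const_of_fderiv_eq_zero hUc.isPreconnected
      (fun x hx => (hu.diffAt hUo hx).differentiableWithinAt) (fun x hx => hz x hx)
    refine ⟨!₂[c, 0], !₂[0, 1], ?_, fun x hx => ⟨F x 1, ?_⟩⟩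
    · intro h
      have := congrArg (fun y : E 2 => y 1) h
      simp at this
    · ext i
      fin_cases i
      · simpa using hc x hx
      · simp
  · push Not at hz
    obtain ⟨x₀, hx₀, hne⟩ := hz
    obtain ⟨j, hj⟩ := exists_single hne
    have hev : ∀ᶠ y in 𝓝 x₀, y ∈ U ∧
        fderiv ℝ (fun x => F x 0) y (EuclideanSpace.single j 1) ≠ 0 := by
      refine Filter.Eventually.and (hUo.eventually_mem hx₀) ?_
      have hc : ContinuousAt
          (fun y => fderiv ℝ (fun x => F x 0) y (EuclideanSpace.single j 1)) x₀ :=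
        (hu.fderiv_diff hUo hx₀).continuousAt.clm_apply continuousAt_const
      exact hc.eventually_ne hj
    obtain ⟨ε, hε, hB⟩ := Metric.eventually_nhds_iff_ball.1 hev
    let lam : E n → ℝ := fun y => fderiv ℝ (fun x => F x 1) y (EuclideanSpace.single j 1) /
      fderiv ℝ (fun x => F x 0) y (EuclideanSpace.single j 1)
    have hlam : ∀ y ∈ ball x₀ ε, fderiv ℝ (fun x => F x 1) y =
        lam y • fderiv ℝ (fun x => F x 0) y := by
      intro y hy
      ext a
      have h1 := hpar y (hB y hy).1 (EuclideanSpace.single j 1) a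
      have h2 := (hB y hy).2
      simp only [ContinuousLinearMap.smul_apply, smul_eq_mul, lam]
      rw [div_mul_eq_mul_div, eq_div_iff h2, ← h1]
      ring
    have hld : ∀ y ∈ ball x₀ ε, DifferentiableAt ℝ lam y := by
      intro y hy
      have h1 : DifferentiableAt ℝ
          (fun z => fderiv ℝ (fun x => F x 1) z (EuclideanSpace.single j 1)) y :=
        (hv.fderiv_diff hUo (hB y hy).1).clm_apply (differentiableAt_const _)
      have h2 : DifferentiableAt ℝ
          (fun z => fderiv ℝ (fun x => F x 0) z (EuclideanSpace.single j 1)) y :=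
        (hu.fderiv_diff hUo (hB y hy).1).clm_apply (differentiableAt_const _)
      have h3 := h1.mul (DifferentiableAt.inv h2 (hB y hy).2)
      have h4 : lam = (fun z => fderiv ℝ (fun x => F x 1) z (EuclideanSpace.single j 1)) *
          (fun z => fderiv ℝ (fun x => F x 0) z (EuclideanSpace.single j 1))⁻¹ := by
        funext z
        simp [lam, div_eq_mul_inv]
      rw [h4]
      exact h3
    have hl0 : ∀ y ∈ ball x₀ ε, fderiv ℝ lam y = 0 := by
      intro y hy
      refine lam_fderiv hUo hu hv (hB y hy).1 (hld y hy) ?_ j (hB y hy).2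
      filter_upwards [isOpen_ball.mem_nhds hy] with z hz using hlam z hz
    have hpc : IsPreconnected (ball x₀ ε) := (convex_ball x₀ ε).isPreconnected
    obtain ⟨l, hl⟩ := isOpen_ball.exists_is_const_of_fderiv_eq_zero hpc
      (fun x hx => (hld x hx).differentiableWithinAt) (fun x hx => hl0 x hx)
    have hw0 : ∀ y ∈ ball x₀ ε, HasFDerivAt (fun x => F x 1 - l * F x 0) (0 : E n →L[ℝ] ℝ) y := by
      intro y hy
      have := (hv.diffAt hUo (hB y hy).1).hasFDerivAt.sub
        ((hu.diffAt hUo (hB y hy).1).hasFDerivAt.const_mul l)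
      rw [hlam y hy, hl y hy, sub_self] at this
      exact this
    obtain ⟨c, hc⟩ := isOpen_ball.exists_is_const_of_fderiv_eq_zero hpc
      (fun x hx => (hw0 x hx).differentiableAt.differentiableWithinAt)
      (fun x hx => (hw0 x hx).fderiv)
    have huc := harm_uc hUo hUc.isPreconnected (hu.comb hUo hv l c) hx₀ (by
      filter_upwards [ball_mem_nhds x₀ hε] with y hy
      rw [hc y hy, sub_self])
    refine ⟨!₂[0, c], !₂[1, l], ?_, fun x hx => ⟨F x 0, ?_⟩⟩
    · intro h
      have := congrArg (fun y : E 2 => y 0) h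
      simp at this
    · have := huc x hx
      ext i
      fin_cases i
      · simp
      · simp
        linarith
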